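/- arXiv:2503.03319 — 6 statements merged into one kernel-verified Lean document; each statement's English description precedes it below -/
import Mathlib

section
/- Let a : ℕ → ℕ satisfy a(0) = 0, |a(n+1) − a(n)| ≤ 1 for all n ∈ ℕ, and a(n) → ∞ as n → ∞. For k ∈ ℕ let τ_k = max{n ∈ ℕ : a(n) ≤ k} (which is finite since a(n) → ∞). Then liminf_{n→∞} a(n)/n = liminf_{k→∞} k/τ_k, and moreover liminf_{k→∞} k/τ_k ≤ limsup_{n→∞} a(n)/n. -/
open Filter

/-- Deterministic core of the last-exit-time lemma: if `a : ℕ → ℕ` starts at `0`,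
has increments bounded by `1`, and tends to infinity, and `τ k` is the last time
`a` is at most `k`, then `liminf a n / n = liminf k / τ k ≤ limsup a n / n`. -/
theorem last_exit_liminf
    (a : ℕ → ℕ) (ha0 : a 0 = 0)
    (hstep : ∀ n : ℕ, |(a (n + 1) : ℤ) - (a n : ℤ)| ≤ 1)
    (hinf : Tendsto a atTop atTop)
    (τ : ℕ → ℕ)
    (hτ : ∀ k : ℕ, a (τ k) ≤ k ∧ ∀ n : ℕ, a n ≤ k → n ≤ τ k) :
    liminf (fun n : ℕ => (a n : ℝ) / n) atTop
      = liminf (fun k : ℕ => (k : ℝ) / (τ k : ℝ)) atTop ∧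
    liminf (fun k : ℕ => (k : ℝ) / (τ k : ℝ)) atTop
      ≤ limsup (fun n : ℕ => (a n : ℝ) / n) atTop := by
  have hle : ∀ n, a n ≤ n := by
    intro n
    induction n with
    | zero => simp [ha0]
    | succ n ih =>
      have h := abs_le.1 (hstep n)
      omega
  have hτk : ∀ k, k ≤ τ k := fun k => (hτ k).2 k (hle k)
  have haτ : ∀ k, a (τ k) = k := by
    intro k
    have h1 := (hτ k).1
    have h2 := abs_le.1 (hstep (τ k))
    have h3 : ¬ a (τ k + 1) ≤ k := fun h => by
      have := (hτ k).2 _ h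
      omega
    omega
  have hτt : Tendsto τ atTop atTop := tendsto_atTop_mono hτk tendsto_id
  set f : ℕ → ℝ := fun n => (a n : ℝ) / n with hf
  set g : ℕ → ℝ := fun k => (k : ℝ) / (τ k : ℝ) with hg
  have hgf : g = f ∘ τ := by
    funext k
    simp [hf, hg, haτ]
  have f0 : ∀ n, 0 ≤ f n := fun n => by positivity
  have f1 : ∀ n, f n ≤ 1 := fun n =>
    div_le_one_of_le₀ (by exact_mod_cast hle n) (by positivity)
  have g0 : ∀ n, 0 ≤ g n := fun n => by positivity
  have g1 : ∀ n, g n ≤ 1 := fun n => by rw [hgf]; exact f1 _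
  have bb : ∀ (u : ℕ → ℝ) (l : Filter ℕ), (∀ n, 0 ≤ u n) → IsBoundedUnder (· ≥ ·) l u :=
    fun u l h => isBoundedUnder_of ⟨0, h⟩
  have ba : ∀ (u : ℕ → ℝ) (l : Filter ℕ), (∀ n, u n ≤ 1) → IsBoundedUnder (· ≤ ·) l u :=
    fun u l h => isBoundedUnder_of ⟨1, h⟩
  have key : ∀ (u : ℕ → ℝ) (s : ℕ → ℕ), (∀ n, 0 ≤ u n) → (∀ n, u n ≤ 1) →
      Tendsto s atTop atTop → liminf u atTop ≤ liminf (u ∘ s) atTop := by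
    intro u s h0 h1 hs
    rw [liminf_comp]
    haveI : NeBot (map s atTop) := inferInstance
    exact liminf_le_liminf_of_le hs (bb u _ h0) (ba u _ h1).isCoboundedUnder_ge
  have e : liminf f atTop = liminf g atTop := by
    apply le_antisymm
    · rw [hgf]
      exact key f τ f0 f1 hτt
    · refine (key g a g0 g1 hinf).trans ?_
      refine liminf_le_liminf ?_ (bb _ _ fun n => g0 _) (ba f _ f1).isCoboundedUnder_ge
      filter_upwards [eventually_gt_atTop 0] with n hn
      have h : n ≤ τ (a n) := (hτ (a n)).2 n le_rfl
      have hn' : (0 : ℝ) < n := by exact_mod_cast hn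
      have h' : (n : ℝ) ≤ τ (a n) := by exact_mod_cast h
      exact div_le_div_of_nonneg_left (by positivity) hn' h'
  refine ⟨e, ?_⟩
  rw [← e]
  exact liminf_le_limsup (ba f _ f1) (bb f _ f0)
end

section
/- Let a : ℕ → ℕ satisfy a(0) = 0, |a(n+1) − a(n)| ≤ 1 for all n ∈ ℕ, and a(n) → ∞ as n → ∞. For k ∈ ℕ let τ_k = max{n ∈ ℕ : a(n) ≤ k} (which is finite since a(n) → ∞). If a(n)/n → s as n → ∞ for some s ∈ (0,1], then τ_k/k → 1/s as k → ∞, and 1/s ≥ 1. -/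
open Filter

/-- Deterministic core of the last-exit-time lemma: if `a : ℕ → ℕ` starts at `0`,
has increments bounded by `1`, tends to infinity, and `a n / n → s` for some
`s ∈ (0,1]`, then `τ k / k → 1/s` and `1/s ≥ 1`, where `τ k` is the last time
`a` is at most `k`. -/
theorem last_exit_speed
    (a : ℕ → ℕ) (ha0 : a 0 = 0)
    (hstep : ∀ n : ℕ, |(a (n + 1) : ℤ) - (a n : ℤ)| ≤ 1)
    (hinf : Tendsto a atTop atTop)
    (τ : ℕ → ℕ)
    (hτ : ∀ k : ℕ, a (τ k) ≤ k ∧ ∀ n : ℕ, a n ≤ k → n ≤ τ k)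
    (s : ℝ) (hs : s ∈ Set.Ioc (0 : ℝ) 1)
    (hspeed : Tendsto (fun n : ℕ => (a n : ℝ) / n) atTop (nhds s)) :
    Tendsto (fun k : ℕ => (τ k : ℝ) / k) atTop (nhds (1 / s)) ∧ 1 ≤ 1 / s := by
  have hle : ∀ n, a n ≤ n := by
    intro n
    induction n with
    | zero => omega
    | succ n ih =>
      have h := abs_le.mp (hstep n)
      omega
  have heq : ∀ k, a (τ k) = k := by
    intro k
    have h1 := (hτ k).1
    have h2 : ¬ a (τ k + 1) ≤ k := fun h => by
      have := (hτ k).2 _ h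
      omega
    have h := abs_le.mp (hstep (τ k))
    omega
  have hτinf : Tendsto τ atTop atTop :=
    tendsto_atTop_mono (fun k => (hτ k).2 k (hle k)) tendsto_id
  have hlim := (hspeed.comp hτinf).inv₀ hs.1.ne'
  refine ⟨?_, (one_le_div hs.1).mpr hs.2⟩
  rw [one_div]
  refine hlim.congr fun k => ?_
  simp only [Function.comp, heq, inv_div]
end

section
/- Let ζ : ℕ → ℝ with ζ_k ≥ 0 for all k and Σ_{k=0}^∞ ζ_k = 1, and let β > 0. Then Σ_{k=0}^∞ ζ_k (Σ_{n=0}^k n·(k choose n)(1−e^{−β})^n e^{−β(k−n)} (1−h(β))^n) = β e^{−β} Σ_{k=1}^∞ k ζ_k ((1+β)e^{−β})^{k−1} = β e^{−β} f'((1+β)e^{−β}). In probabilistic terms: if X_β is a binomial thinning of X ~ ζ with retention probability 1−e^{−β} and Y_β = X_β·1{B(X_β,β)=0}, where conditionally on X_β = n the variable B(X_β,β) is Binomial(n, h(β)), then E[Y_β] = β e^{−β} f'((1+β)e^{−β}). -/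
open Real

/-- `h β = (1 − (1+β)e^{−β})/(1 − e^{−β})`: the probability that a Poisson(β)
random variable is at least 2 given that it is at least 1. -/
noncomputable def h (β : ℝ) : ℝ :=
  (1 - (1 + β) * Real.exp (-β)) / (1 - Real.exp (-β))

theorem sum_mul_choose_aux (x y : ℝ) (k : ℕ) :
    ∑ n ∈ Finset.range (k + 1), (n : ℝ) * (k.choose n : ℝ) * x ^ n * y ^ (k - n)
      = k * x * (x + y) ^ (k - 1) := by
  cases k with
  | zero => simp
  | succ j =>
    rw [Finset.sum_range_succ', Nat.add_sub_cancel, add_pow, Finset.mul_sum]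
    simp only [Nat.cast_zero, zero_mul, add_zero]
    refine Finset.sum_congr rfl fun n _ => ?_
    have hc : ((j : ℝ) + 1) * (j.choose n : ℝ) = ((j + 1).choose (n + 1) : ℝ) * ((n : ℝ) + 1) := by
      exact_mod_cast Nat.add_one_mul_choose_eq j n
    rw [Nat.add_sub_add_right]
    push_cast
    linear_combination (-(x ^ (n + 1) * y ^ (j - n))) * hc

/-- Mean offspring number of the pruned link cluster: if `X_β` is a binomial
thinning of `X ~ ζ` with retention probability `1 − e^{−β}` and
`Y_β = X_β·1{B(X_β,β)=0}` with `B(X_β,β) | X_β = n ~ Bin(n, h(β))`, then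
`E[Y_β] = β e^{−β} f'((1+β)e^{−β})`, where `f'(s) = Σ_{k≥1} k ζ_k s^{k−1}`. -/
theorem mean_pruned_offspring
    (ζ : ℕ → ℝ) (hζ : ∀ k, 0 ≤ ζ k) (hsum : HasSum ζ 1) (β : ℝ) (hβ : 0 < β) :
    (∑' k : ℕ, ζ k *
        ∑ n ∈ Finset.range (k + 1),
          (n : ℝ) * (k.choose n : ℝ) * (1 - Real.exp (-β)) ^ n *
            (Real.exp (-β)) ^ (k - n) * (1 - h β) ^ n)
      = β * Real.exp (-β) *
          ∑' k : ℕ, (k : ℝ) * ζ k * ((1 + β) * Real.exp (-β)) ^ (k - 1) := by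
  have he : 1 - Real.exp (-β) ≠ 0 := by
    have : Real.exp (-β) < 1 := Real.exp_lt_one_iff.mpr (by linarith)
    linarith
  have hx : (1 - Real.exp (-β)) * (1 - h β) = β * Real.exp (-β) := by
    unfold h
    field_simp
    ring
  rw [← tsum_mul_left]
  refine tsum_congr fun k => ?_
  have hs : ∑ n ∈ Finset.range (k + 1),
      (n : ℝ) * (k.choose n : ℝ) * (1 - Real.exp (-β)) ^ n *
        (Real.exp (-β)) ^ (k - n) * (1 - h β) ^ n
      = k * (β * Real.exp (-β)) * ((1 + β) * Real.exp (-β)) ^ (k - 1) := by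
    have hq : (1 + β) * Real.exp (-β) = β * Real.exp (-β) + Real.exp (-β) := by ring
    rw [hq, ← sum_mul_choose_aux]
    refine Finset.sum_congr rfl fun n _ => ?_
    rw [← hx, mul_pow]
    ring
  rw [hs]
  ring
end

section
/- Let ζ : ℕ → ℝ with ζ_k ≥ 0 for all k and Σ_{k=0}^∞ ζ_k = 1. Suppose there exist c > 1/√2 and ε₀ ∈ (0,1) such that √ε · f'(1−ε) ≥ c for all ε ∈ (0, ε₀). Then there exists β₀ > 0 such that for all β ∈ (0, β₀), β e^{−β} f'((1+β)e^{−β}) > 1. -/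
open Real

/-- `f' ζ s = Σ_{k≥1} k ζ_k s^{k−1}`, the derivative of the probability
generating function of `ζ`. -/
noncomputable def fderiv' (ζ : ℕ → ℝ) (s : ℝ) : ℝ :=
  ∑' k : ℕ, (k : ℝ) * ζ k * s ^ (k - 1)

/-- Analytic core of Theorem B: if `√ε · f'(1−ε) ≥ c > 1/√2` for all small
`ε > 0`, then `β e^{−β} f'((1+β)e^{−β}) > 1` for all small `β > 0`. -/
theorem theoremB_analytic_core
    (ζ : ℕ → ℝ) (hζ : ∀ k, 0 ≤ ζ k) (hsum : HasSum ζ 1)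
    (c : ℝ) (hc : 1 / Real.sqrt 2 < c)
    (ε₀ : ℝ) (hε₀ : ε₀ ∈ Set.Ioo (0 : ℝ) 1)
    (hlow : ∀ ε ∈ Set.Ioo (0 : ℝ) ε₀, c ≤ Real.sqrt ε * fderiv' ζ (1 - ε)) :
    ∃ β₀ > (0 : ℝ), ∀ β ∈ Set.Ioo (0 : ℝ) β₀,
      1 < β * Real.exp (-β) * fderiv' ζ ((1 + β) * Real.exp (-β)) := by
  obtain ⟨h0, h1⟩ := hε₀
  have h2 : 0 < Real.sqrt 2 := by positivity
  have hd : 1 < c * Real.sqrt 2 := by rwa [div_lt_iff₀ h2] at hc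
  have hcpos : 0 < c := lt_trans (by positivity) hc
  set d := c * Real.sqrt 2 with hdd
  have hdpos : 0 < d := by linarith
  refine ⟨min ε₀ (1 - 1 / d), lt_min h0 ?_, ?_⟩
  · rw [sub_pos, div_lt_one hdpos]
    exact hd
  rintro β ⟨hb0, hb⟩
  have hb1 : β < ε₀ := lt_of_lt_of_le hb (min_le_left _ _)
  have hb2 : β < 1 - 1 / d := lt_of_lt_of_le hb (min_le_right _ _)
  have hE : 1 - β + β ^ 2 / 2 - 2 / 9 * β ^ 3 ≤ Real.exp (-β) := by
    have h := Real.exp_bound (x := -β) (by rw [abs_neg, abs_of_pos hb0]; linarith)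
      (n := 3) (by norm_num)
    have h := (abs_le.1 h).1
    rw [abs_neg, abs_of_pos hb0] at h
    norm_num [Finset.sum_range_succ, Nat.factorial] at h
    linarith
  have hE1 : 1 - β ≤ Real.exp (-β) := by
    have := Real.add_one_le_exp (-β)
    linarith
  have hEpos := Real.exp_pos (-β)
  obtain ⟨ε, hε⟩ : ∃ ε, ε = 1 - (1 + β) * Real.exp (-β) := ⟨_, rfl⟩
  have hs : (1 + β) * Real.exp (-β) = 1 - ε := by linarith
  have hεpos : 0 < ε := by
    have h := Real.add_one_lt_exp hb0.ne'
    have h3 : Real.exp β * Real.exp (-β) = 1 := by rw [← Real.exp_add]; simp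
    nlinarith
  have hεle : ε ≤ β ^ 2 / 2 := by
    have h := mul_le_mul_of_nonneg_left hE (by linarith : 0 ≤ 1 + β)
    have h3 : 0 ≤ β ^ 3 * (1 - β) := mul_nonneg (by positivity) (by linarith)
    have h4 : 0 < β ^ 3 := by positivity
    nlinarith
  have hεlt : ε < ε₀ := by nlinarith
  have hl := hlow ε ⟨hεpos, hεlt⟩
  rw [hs]
  have hsq : 0 < Real.sqrt ε := Real.sqrt_pos.2 hεpos
  have hsle : Real.sqrt ε * Real.sqrt 2 ≤ β := by
    rw [← Real.sqrt_mul hεpos.le]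
    exact Real.sqrt_le_iff.2 ⟨hb0.le, by linarith⟩
  have hF : 0 < fderiv' ζ (1 - ε) := by
    by_contra hn
    push Not at hn
    nlinarith
  have hA : d ≤ β * fderiv' ζ (1 - ε) := by
    calc d = c * Real.sqrt 2 := hdd
      _ ≤ (Real.sqrt ε * fderiv' ζ (1 - ε)) * Real.sqrt 2 := by gcongr
      _ = (Real.sqrt ε * Real.sqrt 2) * fderiv' ζ (1 - ε) := by ring
      _ ≤ _ := by gcongr
  have hB : 1 / d < Real.exp (-β) := by linarith
  have hC : 1 < Real.exp (-β) * d := (div_lt_iff₀ hdpos).1 hB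
  calc 1 < Real.exp (-β) * d := hC
    _ ≤ Real.exp (-β) * (β * fderiv' ζ (1 - ε)) := by gcongr
    _ = _ := by ring
end

section
/- Let ζ : ℕ → ℝ with ζ_k ≥ 0 for all k and Σ_{k=0}^∞ ζ_k = 1. Suppose there exist c > 0, K ≥ 1 and τ ∈ (1, 3/2) such that ζ_k ≥ c·k^{−τ} for all k ≥ K. Then there exists β₀ > 0 such that for all β ∈ (0, β₀), β e^{−β} f'((1+β)e^{−β}) > 1. -/
open Real

/-- Theorem B with the heavy-tail sufficient condition: if `ζ_k ≥ c k^{−τ}` for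
large `k` with `τ ∈ (1, 3/2)`, then the mean offspring number
`β e^{−β} f'((1+β)e^{−β})` of the pruned link cluster exceeds `1` for all
sufficiently small `β > 0`. -/
theorem theoremB_heavy_tail
    (ζ : ℕ → ℝ) (hζ : ∀ k, 0 ≤ ζ k) (hsum : HasSum ζ 1)
    (c : ℝ) (hc : 0 < c) (K : ℕ) (hK : 1 ≤ K)
    (τ : ℝ) (hτ : τ ∈ Set.Ioo (1 : ℝ) (3 / 2))
    (htail : ∀ k : ℕ, K ≤ k → c * (k : ℝ) ^ (-τ) ≤ ζ k) :
    ∃ β₀ > (0 : ℝ), ∀ β ∈ Set.Ioo (0 : ℝ) β₀,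
      1 < β * Real.exp (-β) * fderiv' ζ ((1 + β) * Real.exp (-β)) := by
  obtain ⟨hτ1, hτ2⟩ := hτ
  have hlim : Filter.Tendsto (fun N : ℕ => (N : ℝ) ^ (3 / 2 - τ)) Filter.atTop Filter.atTop :=
    (tendsto_rpow_atTop (by linarith)).comp tendsto_natCast_atTop_atTop
  obtain ⟨N₁, hN₁⟩ := Filter.eventually_atTop.1 (hlim.eventually_gt_atTop (48 / c))
  set M : ℕ := max N₁ K with hM
  have hM1 : 1 ≤ M := le_trans hK (le_max_right _ _)
  have hM1r : (1 : ℝ) ≤ M := by exact_mod_cast hM1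
  refine ⟨1 / (2 * M), by positivity, ?_⟩
  rintro β ⟨hβ0, hβ1⟩
  have hβM : β * (2 * M) < 1 := by
    rwa [lt_div_iff₀ (by positivity)] at hβ1
  have hβh : β < 1 / 2 := by nlinarith
  set N : ℕ := ⌊1 / (4 * β ^ 2)⌋₊ with hN
  have hNle : (N : ℝ) * (4 * β ^ 2) ≤ 1 := by
    have := Nat.floor_le (show 0 ≤ 1 / (4 * β ^ 2) by positivity)
    rwa [← hN, le_div_iff₀ (by positivity)] at this
  have hMN : M ≤ N := by
    apply Nat.le_floor
    rw [le_div_iff₀ (by positivity)]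
    have : (β * (2 * M)) ^ 2 < 1 := by
      have : 0 ≤ β * (2 * M) := by positivity
      nlinarith
    nlinarith [mul_nonneg (sq_nonneg β) (mul_nonneg (by linarith : (0:ℝ) ≤ M) (sub_nonneg.2 hM1r))]
  have hNK : K ≤ N := le_trans (le_max_right _ _) hMN
  have hN1r : (1 : ℝ) ≤ N := by exact_mod_cast hM1.trans hMN
  have hNpos : (0 : ℝ) < N := by linarith
  have hNbig := hN₁ N (le_trans (le_max_left _ _) hMN)
  have hNlow : 1 < 8 * N * β ^ 2 := by
    have := Nat.lt_floor_add_one (1 / (4 * β ^ 2))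
    rw [← hN, div_lt_iff₀ (by positivity)] at this
    nlinarith [sq_nonneg β, mul_nonneg (sq_nonneg β) (sub_nonneg.2 hN1r)]
  have he : 1 - β ≤ Real.exp (-β) := by linarith [Real.add_one_le_exp (-β)]
  set s : ℝ := (1 + β) * Real.exp (-β) with hs
  have hs0 : 0 < s := by positivity
  have hslow : 1 - β ^ 2 ≤ s := by rw [hs]; nlinarith
  have hs1 : s < 1 := by
    have h := Real.add_one_lt_exp hβ0.ne'
    rw [hs, Real.exp_neg, ← div_eq_mul_inv, div_lt_one (Real.exp_pos _)]; linarith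
  have hζ1 : ∀ k, ζ k ≤ 1 := fun k => le_hasSum hsum k fun j _ => hζ j
  have hnn : ∀ k : ℕ, 0 ≤ (k : ℝ) * ζ k * s ^ (k - 1) := fun k => by
    have := hζ k
    positivity
  have hsm : Summable fun k : ℕ => (k : ℝ) * ζ k * s ^ (k - 1) := by
    have hns : ‖s‖ < 1 := by rw [Real.norm_eq_abs, abs_of_pos hs0]; exact hs1
    have h0 : Summable fun k : ℕ => (k : ℝ) ^ 1 * s ^ k :=
      summable_pow_mul_geometric_of_norm_lt_one (R := ℝ) 1 hns
    have h1 : Summable fun k : ℕ => ((k : ℝ) ^ 1 * s ^ k) * s⁻¹ := h0.mul_right s⁻¹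
    refine Summable.of_nonneg_of_le hnn (fun k => ?_) h1
    rcases k with _ | k
    · simp
    · have : ((k + 1 : ℕ) : ℝ) ^ 1 * s ^ (k + 1) * s⁻¹ = ((k + 1 : ℕ) : ℝ) * 1 * s ^ k := by
        field_simp
        exact pow_succ' s k
      rw [this, Nat.add_sub_cancel]
      gcongr
      exact hζ1 _
  set A : ℝ := (N : ℝ) ^ (-τ) with hA
  have hA0 : 0 < A := by positivity
  have hterm : ∀ k ∈ Finset.Ico N (2 * N), (N : ℝ) * (c * (A / 4)) * (1 / 2) ≤
      (k : ℝ) * ζ k * s ^ (k - 1) := by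
    intro k hk
    rw [Finset.mem_Ico] at hk
    have hk1 : (N : ℝ) ≤ k := by exact_mod_cast hk.1
    have hk2 : (k : ℝ) ≤ 2 * N := by exact_mod_cast hk.2.le
    have hkpos : (0 : ℝ) < k := by linarith
    have h1 : A / 4 ≤ (k : ℝ) ^ (-τ) := by
      calc A / 4 = (2 : ℝ) ^ (-2 : ℝ) * A := by
            rw [Real.rpow_neg (by norm_num)]; norm_num; ring
        _ ≤ (2 : ℝ) ^ (-τ) * A := by
            gcongr
            · norm_num
            · linarith
        _ = (2 * (N : ℝ)) ^ (-τ) := by rw [Real.mul_rpow (by norm_num) hNpos.le]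
        _ ≤ (k : ℝ) ^ (-τ) := Real.rpow_le_rpow_of_nonpos hkpos hk2 (by linarith)
    have h2 : (1 : ℝ) / 2 ≤ s ^ (k - 1) := by
      have hb := one_add_mul_le_pow (show (-2 : ℝ) ≤ -β ^ 2 by nlinarith) k
      have hp : (1 + -β ^ 2) ^ k ≤ s ^ k := by
        apply pow_le_pow_left₀ <;> nlinarith
      have hq : s ^ k ≤ s ^ (k - 1) := pow_le_pow_of_le_one hs0.le hs1.le (Nat.sub_le _ _)
      nlinarith [sq_nonneg β]
    have h3 : c * (A / 4) ≤ ζ k :=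
      le_trans (by gcongr) (htail k (hNK.trans hk.1))
    have := hζ k
    gcongr
  have hsumlow : (N : ℝ) * ((N : ℝ) * (c * (A / 4)) * (1 / 2)) ≤ fderiv' ζ s := by
    have h1 := Finset.card_nsmul_le_sum _ _ _ hterm
    have h2 := hsm.sum_le_tsum (Finset.Ico N (2 * N)) (fun k _ => hnn k)
    rw [Nat.card_Ico, nsmul_eq_mul, show 2 * N - N = N by omega] at h1
    exact h1.trans h2
  set B : ℝ := (N : ℝ) ^ (3 / 2 - τ) with hB
  set R : ℝ := Real.sqrt N with hR
  have hRpos : 0 < R := Real.sqrt_pos.2 hNpos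
  have hRR : R ^ 2 = N := Real.sq_sqrt hNpos.le
  have hAB : (N : ℝ) * N * A = B * R := by
    rw [hA, hB, hR, Real.sqrt_eq_rpow, ← Real.rpow_add hNpos, ← sq, ← Real.rpow_natCast,
      ← Real.rpow_add hNpos]
    congr 1
    push_cast
    ring
  have hβR : 1 ≤ 3 * (β * R) := by
    have : 1 < 8 * (β * R) ^ 2 := by rw [mul_pow, hRR]; linarith
    have h0 : 0 < β * R := by positivity
    nlinarith
  have hcB : 48 < B * c := by rwa [div_lt_iff₀ hc] at hNbig
  have hfl : B * c * R / 8 ≤ fderiv' ζ s := by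
    refine le_trans (le_of_eq ?_) hsumlow
    linear_combination (-c / 8) * hAB
  calc (1 : ℝ) < B * c / 48 := by linarith
    _ ≤ B * c / 48 * (3 * (β * R)) := le_mul_of_one_le_right (by linarith) hβR
    _ = β * (1 / 2) * (B * c * R / 8) := by ring
    _ ≤ β * Real.exp (-β) * fderiv' ζ s := by
        have : 0 ≤ B * c * R / 8 := by have : 0 < B * c := by linarith
                                       positivity
        have : 1 / 2 ≤ Real.exp (-β) := by linarith
        gcongr
end

section
/- Fix u₀ ∈ (0,1] and integers d ≥ 2, d* ≥ 1. Then lim_{λ → 0+} R(d, d*, λ) = 0 (limit along λ ↓ 0 within (0,∞)) and lim_{λ → ∞} R(d, d*, λ) = 0. -/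
open Real Filter

/-- The pruning probability `R(d, d*, λ)` of a vertex of degree `d` whose
minimal-degree child has degree `d*` in the loop model at intensity `λ` with
cross weight `u₀`. -/
noncomputable def R (u₀ : ℝ) (d dstar : ℕ) (lam : ℝ) : ℝ :=
  lam ^ 3 * Real.exp (-2 * lam) * u₀ ^ 2 / (2 * (1 - Real.exp (-lam)) ^ 2) *
    ∫ u in (0 : ℝ)..1, ∫ v in (0 : ℝ)..1,
      (Real.exp (-lam) * (Real.exp (lam * (1 - |u - v|)) - 1) /
          (1 - Real.exp (-lam))) ^ (dstar - 1) *
        (Real.exp (-lam) * (Real.exp (lam * |u - v|) - 1) /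
          (1 - Real.exp (-lam))) ^ (d - 2)

theorem ratio_bound_aux (lam t : ℝ) (hl : 0 < lam) (h0 : 0 ≤ t) (h1 : t ≤ 1) :
    0 ≤ Real.exp (-lam) * (Real.exp (lam * t) - 1) / (1 - Real.exp (-lam)) ∧
    Real.exp (-lam) * (Real.exp (lam * t) - 1) / (1 - Real.exp (-lam)) ≤ 1 := by
  have hlt : Real.exp (-lam) < 1 := by
    rw [Real.exp_lt_one_iff]; linarith
  have hp : 0 < 1 - Real.exp (-lam) := by linarith
  have hge : 1 ≤ Real.exp (lam * t) := Real.one_le_exp (by positivity)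
  have hle : Real.exp (lam * t) ≤ Real.exp lam := Real.exp_le_exp.2 (by nlinarith)
  have hm : Real.exp (-lam) * Real.exp lam = 1 := by rw [← Real.exp_add]; simp
  have he := Real.exp_pos (-lam)
  constructor
  · apply div_nonneg _ hp.le
    exact mul_nonneg he.le (by linarith)
  · rw [div_le_one hp]
    nlinarith

theorem R_bound_aux (u₀ : ℝ) (hu₀ : u₀ ∈ Set.Ioc (0 : ℝ) 1) (d dstar : ℕ) (lam : ℝ)
    (hl : 0 < lam) : |R u₀ d dstar lam| ≤ lam ^ 3 / (Real.exp lam - 1) ^ 2 := by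
  have hI : ‖∫ u in (0 : ℝ)..1, ∫ v in (0 : ℝ)..1,
      (Real.exp (-lam) * (Real.exp (lam * (1 - |u - v|)) - 1) /
          (1 - Real.exp (-lam))) ^ (dstar - 1) *
        (Real.exp (-lam) * (Real.exp (lam * |u - v|) - 1) /
          (1 - Real.exp (-lam))) ^ (d - 2)‖ ≤ 1 := by
    refine (intervalIntegral.norm_integral_le_of_norm_le_const (C := 1) ?_).trans (by simp)
    intro u hu
    refine (intervalIntegral.norm_integral_le_of_norm_le_const (C := 1) ?_).trans (by simp)
    intro v hv
    rw [Set.uIoc_of_le zero_le_one] at hu hv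
    have ht : |u - v| ≤ 1 := by
      rw [abs_le]; constructor <;> linarith [hu.1, hu.2, hv.1, hv.2]
    have ht0 := abs_nonneg (u - v)
    obtain ⟨a0, a1⟩ := ratio_bound_aux lam (1 - |u - v|) hl (by linarith) (by linarith)
    obtain ⟨b0, b1⟩ := ratio_bound_aux lam (|u - v|) hl ht0 ht
    rw [Real.norm_eq_abs, abs_of_nonneg (by positivity)]
    exact mul_le_one₀ (pow_le_one₀ a0 a1) (by positivity) (pow_le_one₀ b0 b1)
  have hE : 0 < Real.exp lam - 1 := by linarith [Real.add_one_lt_exp hl.ne']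
  have hpre : lam ^ 3 * Real.exp (-2 * lam) * u₀ ^ 2 / (2 * (1 - Real.exp (-lam)) ^ 2)
      = lam ^ 3 / (Real.exp lam - 1) ^ 2 * (u₀ ^ 2 / 2) := by
    have h2 : Real.exp (-2 * lam) = (Real.exp lam)⁻¹ ^ 2 := by
      rw [← Real.exp_neg, ← Real.exp_nat_mul]; congr 1; push_cast; ring
    have h3 : 1 - Real.exp (-lam) = (Real.exp lam)⁻¹ * (Real.exp lam - 1) := by
      rw [Real.exp_neg, mul_sub, inv_mul_cancel₀ (Real.exp_pos _).ne']; ring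
    have h4 := (Real.exp_pos lam).ne'
    rw [h2, h3]
    field_simp
  have hu : u₀ ^ 2 / 2 ≤ 1 := by nlinarith [hu₀.1, hu₀.2]
  unfold R
  rw [abs_mul, hpre, abs_of_nonneg (by positivity)]
  rw [Real.norm_eq_abs] at hI
  have hq : 0 ≤ lam ^ 3 / (Real.exp lam - 1) ^ 2 := by positivity
  have hr := mul_le_of_le_one_right hq hu
  exact (mul_le_of_le_one_right (by positivity) hI).trans hr

/-- The pruning probability vanishes as `λ → 0+` and as `λ → ∞`. -/
theorem R_vanishes_in_lambda (u₀ : ℝ) (hu₀ : u₀ ∈ Set.Ioc (0 : ℝ) 1)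
    (d dstar : ℕ) (hd : 2 ≤ d) (hdstar : 1 ≤ dstar) :
    Tendsto (fun lam : ℝ => R u₀ d dstar lam)
        (nhdsWithin 0 (Set.Ioi (0 : ℝ))) (nhds 0) ∧
      Tendsto (fun lam : ℝ => R u₀ d dstar lam) atTop (nhds 0) := by
  have hzero : ∀ lam : ℝ, 0 < lam → |R u₀ d dstar lam| ≤ lam := by
    intro lam hl
    refine (R_bound_aux u₀ hu₀ d dstar lam hl).trans ?_
    have h1 : lam ≤ Real.exp lam - 1 := by linarith [Real.add_one_le_exp lam]
    have h2 : lam ^ 2 ≤ (Real.exp lam - 1) ^ 2 := by gcongr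
    rw [div_le_iff₀ (lt_of_lt_of_le (by positivity) h2)]
    nlinarith
  have hinf : ∀ lam : ℝ, 0 < lam → |R u₀ d dstar lam| ≤ 4 * lam⁻¹ := by
    intro lam hl
    refine (R_bound_aux u₀ hu₀ d dstar lam hl).trans ?_
    have h1 : lam ^ 2 / 2 ≤ Real.exp lam - 1 := by
      linarith [Real.quadratic_le_exp_of_nonneg hl.le]
    have h2 : (lam ^ 2 / 2) ^ 2 ≤ (Real.exp lam - 1) ^ 2 := by gcongr
    calc lam ^ 3 / (Real.exp lam - 1) ^ 2 ≤ lam ^ 3 / (lam ^ 2 / 2) ^ 2 := by gcongr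
      _ = 4 * lam⁻¹ := by field_simp; norm_num
  constructor
  · refine squeeze_zero_norm' (a := fun lam : ℝ => lam) ?_ ?_
    · filter_upwards [self_mem_nhdsWithin] with lam hl
      exact hzero lam hl
    · exact tendsto_nhdsWithin_of_tendsto_nhds tendsto_id
  · refine squeeze_zero_norm' (a := fun lam : ℝ => 4 * lam⁻¹) ?_ ?_
    · filter_upwards [eventually_gt_atTop 0] with lam hl
      exact hinf lam hl
    · simpa using (tendsto_inv_atTop_zero (𝕜 := ℝ)).const_mul 4
end
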